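/- arXiv:2106.02620 — 2 statements merged into one kernel-verified Lean document; each statement's English description precedes it below -/
import Mathlib

section
/- Let B be a C*-algebra, let p and q be idempotents in B, and let b be an invertible morphism from p to q with inverse c. Then the matrix [[0, c], [−b, 0]] in M₂(B) is an invertible morphism from diag(p,q) to diag(p,q), and it is joined to diag(p,q) by a continuous path of invertible morphisms from diag(p,q) to diag(p,q). Explicitly, the path t ↦ [[p, t·c],[0, q]] · [[p, 0],[−t·b, q]] · [[p, t·c],[0, q]] for t ∈ [0,1] is continuous, takes the value diag(p,q) at t = 0 and [[0, c],[−b, 0]] at t = 1, and each of its values is an invertible morphism from diag(p,q) to diag(p,q). -/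
/-- `b` is a morphism from the idempotent `p` to the idempotent `q`,
i.e. `b = q * b * p`. -/
def IsMor {R : Type*} [Mul R] (p q b : R) : Prop := b = q * b * p

/-- `b` is an invertible morphism from the idempotent `p` to the idempotent `q`:
it is a morphism from `p` to `q` and there is a morphism `c` from `q` to `p` with
`c * b = p` and `b * c = q`. -/
def IsInvMor {R : Type*} [Mul R] (p q b : R) : Prop :=
  IsMor p q b ∧ ∃ c, IsMor q p c ∧ c * b = p ∧ b * c = q

/-- The 2×2 diagonal matrix `diag(x, y)`. -/
def mdiag {R : Type*} [Zero R] (x y : R) : Matrix (Fin 2) (Fin 2) R := !![x, 0; 0, y]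

theorem IsMor.left_mul {R : Type*} [Semigroup R] {p q b : R} (h : IsMor p q b)
    (hq : q * q = q) : q * b = b := by
  unfold IsMor at h
  rw [h, ← mul_assoc, ← mul_assoc, hq]

theorem IsMor.mul_right {R : Type*} [Semigroup R] {p q b : R} (h : IsMor p q b)
    (hp : p * p = p) : b * p = b := by
  unfold IsMor at h
  rw [h, mul_assoc, hp]

theorem IsMor.of_mul_eq {R : Type*} [Semigroup R] {p q b : R} (hl : q * b = b)
    (hr : b * p = b) : IsMor p q b := by
  rw [IsMor, hl, hr]

theorem IsMor.comp {R : Type*} [Semigroup R] {p q r a b : R} (hp : p * p = p)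
    (hr : r * r = r) (ha : IsMor q r a) (hb : IsMor p q b) :
    IsMor p r (a * b) :=
  .of_mul_eq (by rw [← mul_assoc, ha.left_mul hr]) (by rw [mul_assoc, hb.mul_right hp])

/-- Invertible morphisms between idempotents compose. -/
theorem IsInvMor.comp {R : Type*} [Semigroup R] {p q r a b : R} (hp : p * p = p)
    (hq : q * q = q) (hr : r * r = r) (ha : IsInvMor q r a) (hb : IsInvMor p q b) :
    IsInvMor p r (a * b) := by
  obtain ⟨ha, a', ha', h1, h2⟩ := ha
  obtain ⟨hb, b', hb', h3, h4⟩ := hb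
  refine ⟨.comp hp hr ha hb, b' * a', .comp hr hp hb' ha', ?_, ?_⟩
  · rw [mul_assoc, ← mul_assoc a', h1, hb.left_mul hq, h3]
  · rw [mul_assoc, ← mul_assoc b, h4, ha'.left_mul hq, h2]

theorem mdiag_mul_self {R : Type*} [NonUnitalRing R] {p q : R} (hp : p * p = p)
    (hq : q * q = q) : mdiag p q * mdiag p q = mdiag p q := by
  simp [mdiag, hp, hq]

theorem isInvMor_upper {R : Type*} [NonUnitalRing R] {p q c : R} (hp : p * p = p)
    (hq : q * q = q) (hpc : p * c = c) (hcq : c * q = c) :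
    IsInvMor (mdiag p q) (mdiag p q) !![p, c; 0, q] := by
  refine ⟨.of_mul_eq ?_ ?_, !![p, -c; 0, q], .of_mul_eq ?_ ?_, ?_, ?_⟩ <;>
    simp [mdiag, hp, hq, hpc, hcq]

theorem isInvMor_lower {R : Type*} [NonUnitalRing R] {p q b : R} (hp : p * p = p)
    (hq : q * q = q) (hqb : q * b = b) (hbp : b * p = b) :
    IsInvMor (mdiag p q) (mdiag p q) !![p, 0; b, q] := by
  refine ⟨.of_mul_eq ?_ ?_, !![p, 0; -b, q], .of_mul_eq ?_ ?_, ?_, ?_⟩ <;>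
    simp [mdiag, hp, hq, hqb, hbp]

/-- Given idempotents `p`, `q` in a C*-algebra `B` and an invertible morphism `b`
from `p` to `q` with inverse `c`, the matrix `[[0, c], [-b, 0]]` is an invertible
morphism from `diag(p,q)` to `diag(p,q)`, and the explicit path
`t ↦ [[p, t•c; 0, q]] * [[p, 0; -t•b, q]] * [[p, t•c; 0, q]]` is a continuous path
of invertible morphisms from `diag(p,q)` to `diag(p,q)` joining `diag(p,q)` (at `t = 0`)
to `[[0, c], [-b, 0]]` (at `t = 1`). -/
theorem statement0 {B : Type*} [NonUnitalCStarAlgebra B] (p q b c : B)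
    (hp : p * p = p) (hq : q * q = q)
    (hbm : IsMor p q b) (hcm : IsMor q p c) (hcb : c * b = p) (hbc : b * c = q) :
    IsInvMor (mdiag p q) (mdiag p q) !![(0 : B), c; -b, 0] ∧
    ContinuousOn (fun t : ℝ =>
        !![p, t • c; 0, q] * !![p, 0; -(t • b), q] * !![p, t • c; 0, q])
      (Set.Icc 0 1) ∧
    !![p, (0 : ℝ) • c; 0, q] * !![p, 0; -((0 : ℝ) • b), q] * !![p, (0 : ℝ) • c; 0, q]
      = mdiag p q ∧
    !![p, (1 : ℝ) • c; 0, q] * !![p, 0; -((1 : ℝ) • b), q] * !![p, (1 : ℝ) • c; 0, q]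
      = !![(0 : B), c; -b, 0] ∧
    ∀ t ∈ Set.Icc (0 : ℝ) 1,
      IsInvMor (mdiag p q) (mdiag p q)
        (!![p, t • c; 0, q] * !![p, 0; -(t • b), q] * !![p, t • c; 0, q]) := by
  have hqb := hbm.left_mul hq
  have hbp := hbm.mul_right hp
  have hpc := hcm.left_mul hp
  have hcq := hcm.mul_right hq
  have hd := mdiag_mul_self hp hq
  have hpath (t : ℝ) : IsInvMor (mdiag p q) (mdiag p q)
      (!![p, t • c; 0, q] * !![p, 0; -(t • b), q] * !![p, t • c; 0, q]) := by
    have hu : IsInvMor (mdiag p q) (mdiag p q) !![p, t • c; 0, q] :=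
      isInvMor_upper hp hq (by rw [mul_smul_comm, hpc]) (by rw [smul_mul_assoc, hcq])
    have hl : IsInvMor (mdiag p q) (mdiag p q) !![p, 0; -(t • b), q] :=
      isInvMor_lower hp hq (by rw [mul_neg, mul_smul_comm, hqb])
        (by rw [neg_mul, smul_mul_assoc, hbp])
    exact .comp hd hd hd (.comp hd hd hd hu hl) hu
  have h1 : !![p, (1 : ℝ) • c; 0, q] * !![p, 0; -((1 : ℝ) • b), q] *
      !![p, (1 : ℝ) • c; 0, q] = !![(0 : B), c; -b, 0] := by
    simp [hp, hq, hqb, hbp, hcq, hcb, hbc]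
  refine ⟨h1 ▸ hpath 1, Continuous.continuousOn ?_, ?_, h1, fun t _ => hpath t⟩
  · refine ((Continuous.matrix_mul ?_ ?_).matrix_mul ?_) <;>
      refine continuous_matrix fun i j => ?_ <;> fin_cases i <;> fin_cases j <;>
      simp <;> fun_prop
  · simp [mdiag, hp, hq]
end

section
/- Let B be a C*-algebra, let p and q be projections (self-adjoint idempotents) in B, and let b be an invertible morphism from p to q with inverse c. Then b·b* lies in the unital C*-algebra qBq = {x ∈ B : x = q·x·q} (with unit q), it is positive and invertible there with inverse c*·c, the element v := (b·b*)^{−1/2}·b (the inverse square root computed in qBq) is a partial isometry with v*·v = p and v·v* = q, and the map t ↦ (b·b*)^{−t/2}·b for t ∈ [0,1] is a continuous path of invertible morphisms from p to q joining b (at t = 0) to v (at t = 1). -/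
/-- For `x` a positive element of the corner C*-algebra `qBq` (with unit `q`) which is
invertible in `qBq`, `cornerPow q x s` is the power `x ^ s` computed by continuous
functional calculus in the unital C*-algebra `qBq`.  It is encoded as
`q + f(x)` where `f r = r ^ s - 1` on the spectrum of `x` in `qBq` (which is bounded
away from `0`) and `f 0 = 0`, using the non-unital functional calculus of `B`. -/
noncomputable def cornerPow {B : Type*} [NonUnitalCStarAlgebra B] (q x : B) (s : ℝ) : B :=
  q + cfcₙ (fun r : ℝ => if r = 0 then 0 else r ^ s - 1) x

open Set in
/-- The power function extended by `0` at the origin is jointly continuous away from `0`. -/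
theorem continuousOn_ite_rpow {ε : ℝ} (hε : 0 < ε) :
    ContinuousOn (fun z : ℝ × ℝ => if z.2 = 0 then 0 else z.2 ^ z.1) (univ ×ˢ ({0} ∪ Ici ε)) := by
  have hc : Continuous fun z : ℝ × ℝ => min 1 (z.2 / ε) * (max z.2 ε) ^ z.1 := by
    refine Continuous.mul (by fun_prop) ?_
    exact Continuous.rpow (by fun_prop) (by fun_prop)
      fun z => Or.inl (hε.trans_le (le_max_right _ _)).ne'
  refine hc.continuousOn.congr ?_
  rintro ⟨s, r⟩ ⟨-, rfl | hr⟩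
  · simp
  · have hr' : ε ≤ r := hr
    simp [(hε.trans_le hr').ne', hr', (one_le_div hε).2 hr']

/-- If `x` has inverse `y` in the corner of `q`, then the nonzero spectrum of `x` is controlled by
the invertibility of `1 - r • y`. -/
theorem isUnit_algebraMap_sub_of_corner_inverse {A : Type*} [Ring A] [Algebra ℝ A] {q x y : A}
    (hq : q * q = q) (hqx : q * x = x) (hxq : x * q = x) (hqy : q * y = y) (hyq : y * q = y)
    (hxy : x * y = q) (hyx : y * x = q) {r : ℝ} (hr : r ≠ 0) (h : IsUnit (1 - r • y)) :
    IsUnit (algebraMap ℝ A r - x) := by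
  have h₁ : IsUnit (x + (1 - q)) :=
    ⟨⟨x + (1 - q), y + (1 - q),
      (by simp only [mul_add, add_mul, mul_sub, sub_mul, mul_one, one_mul, *]; abel),
      (by simp only [mul_add, add_mul, mul_sub, sub_mul, mul_one, one_mul, *]; abel)⟩, rfl⟩
  have h₂ : IsUnit (r • (1 - q) - q) :=
    ⟨⟨r • (1 - q) - q, r⁻¹ • (1 - q) - q,
      (by simp [mul_sub, sub_mul, smul_smul, *]),
      (by simp [mul_sub, sub_mul, smul_smul, *])⟩, rfl⟩
  convert (h₁.mul h).mul h₂ using 1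
  simp only [Algebra.algebraMap_eq_smul_one, add_mul, mul_sub, sub_mul, mul_one, one_mul,
    mul_smul_comm, smul_mul_assoc, smul_sub, *]
  module

open Set in
/-- A positive element of a C⋆-algebra which is invertible in a corner has quasispectrum
isolated from `0`. -/
theorem exists_quasispectrum_subset_of_corner_inverse {B : Type*} [NonUnitalCStarAlgebra B]
    [PartialOrder B] [StarOrderedRing B] {q x y : B} (hx : 0 ≤ x)
    (hq : q * q = q) (hqx : q * x = x) (hxq : x * q = x) (hqy : q * y = y) (hyq : y * q = y)
    (hxy : x * y = q) (hyx : y * x = q) :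
    ∃ ε : ℝ, 0 < ε ∧ quasispectrum ℝ x ⊆ {0} ∪ Ici ε := by
  refine ⟨(‖y‖ + 1)⁻¹, by positivity, fun r hr => ?_⟩
  have hr0 : 0 ≤ r := quasispectrum_nonneg_of_nonneg x hx r hr
  by_contra hcon
  simp only [mem_union, mem_singleton_iff, mem_Ici, not_or, not_le] at hcon
  rw [Unitization.quasispectrum_eq_spectrum_inr' ℝ ℂ, spectrum.mem_iff] at hr
  have hinr {a b c : B} (h : a * b = c) : (a : Unitization ℂ B) * b = c := by
    rw [← Unitization.inr_mul, h]
  refine hr (isUnit_algebraMap_sub_of_corner_inverse (hinr hq) (hinr hqx) (hinr hxq) (hinr hqy)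
    (hinr hyq) (hinr hxy) (hinr hyx) hcon.1 (isUnit_one_sub_of_norm_lt_one ?_))
  rw [← Unitization.inr_smul, Unitization.norm_inr, norm_smul, Real.norm_of_nonneg hr0]
  calc r * ‖y‖ ≤ r * (‖y‖ + 1) := by gcongr; simp
    _ < (‖y‖ + 1)⁻¹ * (‖y‖ + 1) := by gcongr; exact hcon.2
    _ = 1 := inv_mul_cancel₀ (by positivity)

section CornerPow

variable {B : Type*} [NonUnitalCStarAlgebra B] {x : B} {ε : ℝ}

open Set

theorem continuousOn_ite_rpow_quasispectrum (hε : 0 < ε)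
    (hσ : quasispectrum ℝ x ⊆ {0} ∪ Ici ε) (s : ℝ) :
    ContinuousOn (fun r : ℝ => if r = 0 then 0 else r ^ s) (quasispectrum ℝ x) :=
  (continuousOn_ite_rpow hε).comp (f := fun r : ℝ => (s, r)) (by fun_prop)
    fun _ hr => ⟨mem_univ _, hσ hr⟩

theorem continuous_cfcₙ_ite_rpow (hε : 0 < ε) (hσ : quasispectrum ℝ x ⊆ {0} ∪ Ici ε) :
    Continuous fun s : ℝ => cfcₙ (fun r : ℝ => if r = 0 then 0 else r ^ s) x := by
  refine continuous_iff_continuousAt.2 fun s => continuousAt_cfcₙ_fun ?_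
    (.of_forall (continuousOn_ite_rpow_quasispectrum hε hσ)) (.of_forall fun _ => if_pos rfl)
  have hu : UniformContinuousOn (fun z : ℝ × ℝ => if z.2 = 0 then 0 else z.2 ^ z.1)
      (Icc (s - 1) (s + 1) ×ˢ quasispectrum ℝ x) :=
    (isCompact_Icc.prod (quasispectrum.isCompact x)).uniformContinuousOn_of_continuous
      ((continuousOn_ite_rpow hε).mono (prod_mono (subset_univ _) hσ))
  have h := UniformContinuousOn.tendstoUniformlyOn (x := s)
    (F := fun s r : ℝ => if r = 0 then 0 else r ^ s) hu ⟨by simp, by simp⟩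
  rwa [nhdsWithin_eq_nhds.2 (Icc_mem_nhds (by simp) (by simp))] at h

theorem cfcₙ_ite_rpow_mul (hε : 0 < ε) (hσ : quasispectrum ℝ x ⊆ {0} ∪ Ici ε) (s t : ℝ) :
    cfcₙ (fun r : ℝ => if r = 0 then 0 else r ^ s) x *
      cfcₙ (fun r : ℝ => if r = 0 then 0 else r ^ t) x =
      cfcₙ (fun r : ℝ => if r = 0 then 0 else r ^ (s + t)) x := by
  rw [← cfcₙ_mul _ _ x (continuousOn_ite_rpow_quasispectrum hε hσ s) (if_pos rfl)
    (continuousOn_ite_rpow_quasispectrum hε hσ t) (if_pos rfl)]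
  refine cfcₙ_congr fun r hr => ?_
  rcases hσ hr with rfl | hr
  · simp
  · have h0 : 0 < r := hε.trans_le hr
    simp [h0.ne', Real.rpow_add h0]

theorem cfcₙ_ite_rpow_one (hx : IsSelfAdjoint x) :
    cfcₙ (fun r : ℝ => if r = 0 then 0 else r ^ (1 : ℝ)) x = x := by
  have h : (fun r : ℝ => if r = 0 then 0 else r ^ (1 : ℝ)) = fun r => r := by
    ext r; simp +contextual [eq_comm]
  rw [h, cfcₙ_id' ℝ x]

theorem cfcₙ_ite_rpow_zero (hx : IsSelfAdjoint x) (hε : 0 < ε)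
    (hσ : quasispectrum ℝ x ⊆ {0} ∪ Ici ε) {q y : B} (hqx : q * x = x)
    (hyx : y * x = q) :
    cfcₙ (fun r : ℝ => if r = 0 then 0 else r ^ (0 : ℝ)) x = q := by
  have h₁ := cfcₙ_ite_rpow_mul hε hσ 0 1
  have h₂ := cfcₙ_ite_rpow_mul hε hσ 1 (-1)
  have h₃ := cfcₙ_ite_rpow_mul hε hσ 1 0
  simp only [zero_add, add_zero, add_neg_cancel, cfcₙ_ite_rpow_one hx] at h₁ h₂ h₃
  generalize cfcₙ (fun r : ℝ => if r = 0 then 0 else r ^ (0 : ℝ)) x = e at h₁ h₂ h₃ ⊢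
  rw [← h₂, ← hqx, mul_assoc, hqx, h₂, ← hyx, mul_assoc, h₃]

theorem cornerPow_eq_cfcₙ_ite_rpow (hx : IsSelfAdjoint x) (hε : 0 < ε)
    (hσ : quasispectrum ℝ x ⊆ {0} ∪ Ici ε) {q y : B} (hqx : q * x = x)
    (hyx : y * x = q) (s : ℝ) :
    cornerPow q x s = cfcₙ (fun r : ℝ => if r = 0 then 0 else r ^ s) x := by
  have h : (fun r : ℝ => if r = 0 then 0 else r ^ s - 1) =
      fun r : ℝ => (if r = 0 then 0 else r ^ s) - if r = 0 then 0 else r ^ (0 : ℝ) := by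
    ext r; by_cases hr : r = 0 <;> simp [hr]
  rw [cornerPow, h, cfcₙ_sub _ _ x (continuousOn_ite_rpow_quasispectrum hε hσ s) (if_pos rfl)
    (continuousOn_ite_rpow_quasispectrum hε hσ 0) (if_pos rfl),
    cfcₙ_ite_rpow_zero hx hε hσ hqx hyx, add_sub_cancel]

/-- The functional calculus facts about powers of a positive element `x` that has an inverse `y`
in the corner of `q`. -/
theorem cornerPow_properties [PartialOrder B] [StarOrderedRing B] {q y : B} (hx : 0 ≤ x)
    (hq : q * q = q) (hqx : q * x = x) (hxq : x * q = x) (hqy : q * y = y) (hyq : y * q = y)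
    (hxy : x * y = q) (hyx : y * x = q) :
    (∀ s t, cornerPow q x s * cornerPow q x t = cornerPow q x (s + t)) ∧
      cornerPow q x 0 = q ∧ cornerPow q x 1 = x ∧ (∀ s, star (cornerPow q x s) = cornerPow q x s) ∧
      Continuous (cornerPow q x) := by
  obtain ⟨ε, hε, hσ⟩ :=
    exists_quasispectrum_subset_of_corner_inverse hx hq hqx hxq hqy hyq hxy hyx
  have hsa := IsSelfAdjoint.of_nonneg hx
  have h := funext (cornerPow_eq_cfcₙ_ite_rpow hsa hε hσ hqx hyx)
  simp only [h]
  exact ⟨cfcₙ_ite_rpow_mul hε hσ, cfcₙ_ite_rpow_zero hsa hε hσ hqx hyx,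
    cfcₙ_ite_rpow_one hsa, fun s => cfcₙ_predicate (p := IsSelfAdjoint) _ x,
    continuous_cfcₙ_ite_rpow hε hσ⟩

end CornerPow

/-- Let `p`, `q` be projections in a C*-algebra `B` and let `b` be an invertible
morphism from `p` to `q` with inverse `c`.  Then `b * b*` lies in the corner
`qBq`, is positive, and is invertible in `qBq` with inverse `c* * c`; the element
`v := (b * b*)^(-1/2) * b` (inverse square root computed in `qBq`) is a partial
isometry with `v* * v = p` and `v * v* = q`; and `t ↦ (b * b*)^(-t/2) * b` is a
continuous path of invertible morphisms from `p` to `q` joining `b` (at `t = 0`)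
to `v` (at `t = 1`). -/
theorem statement4 {B : Type*} [NonUnitalCStarAlgebra B]
    [PartialOrder B] [StarOrderedRing B] (p q b c : B)
    (hp : p * p = p) (hps : star p = p) (hq : q * q = q) (hqs : star q = q)
    (hbm : IsMor p q b) (hcm : IsMor q p c) (hcb : c * b = p) (hbc : b * c = q) :
    b * star b = q * (b * star b) * q ∧
    0 ≤ b * star b ∧
    star c * c = q * (star c * c) * q ∧
    (b * star b) * (star c * c) = q ∧ (star c * c) * (b * star b) = q ∧
    (cornerPow q (b * star b) (-(1 / 2 : ℝ)) * b) * star (cornerPow q (b * star b) (-(1 / 2 : ℝ)) * b)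
        * (cornerPow q (b * star b) (-(1 / 2 : ℝ)) * b)
      = cornerPow q (b * star b) (-(1 / 2 : ℝ)) * b ∧
    star (cornerPow q (b * star b) (-(1 / 2 : ℝ)) * b)
        * (cornerPow q (b * star b) (-(1 / 2 : ℝ)) * b) = p ∧
    (cornerPow q (b * star b) (-(1 / 2 : ℝ)) * b)
        * star (cornerPow q (b * star b) (-(1 / 2 : ℝ)) * b) = q ∧
    ContinuousOn (fun t : ℝ => cornerPow q (b * star b) (-(t / 2)) * b) (Set.Icc 0 1) ∧
    cornerPow q (b * star b) (-((0 : ℝ) / 2)) * b = b ∧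
    cornerPow q (b * star b) (-((1 : ℝ) / 2)) * b
      = cornerPow q (b * star b) (-(1 / 2 : ℝ)) * b ∧
    ∀ t ∈ Set.Icc (0 : ℝ) 1,
      IsInvMor p q (cornerPow q (b * star b) (-(t / 2)) * b) := by
  have hqb : q * b = b := by rw [hbm, ← mul_assoc, ← mul_assoc, hq]
  have hbp : b * p = b := by rw [hbm, mul_assoc, hp]
  have hpc : p * c = c := by rw [hcm, ← mul_assoc, ← mul_assoc, hp]
  have hcq : c * q = c := by rw [hcm, mul_assoc, hq]
  have hsbq : star b * q = star b := by simpa [hqs] using congrArg star hqb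
  have hpsb : p * star b = star b := by simpa [hps] using congrArg star hbp
  have hscp : star c * p = star c := by simpa [hps] using congrArg star hpc
  have hqsc : q * star c = star c := by simpa [hqs] using congrArg star hcq
  have hsbc : star b * star c = p := by rw [← star_mul, hcb, hps]
  have hscb : star c * star b = q := by rw [← star_mul, hbc, hqs]
  set x := b * star b with hxdef
  set y := star c * c with hydef
  have hx : 0 ≤ x := mul_star_self_nonneg b
  have hqx : q * x = x := by rw [hxdef, ← mul_assoc, hqb]
  have hxq : x * q = x := by rw [hxdef, mul_assoc, hsbq]
  have hqy : q * y = y := by rw [hydef, ← mul_assoc, hqsc]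
  have hyq : y * q = y := by rw [hydef, mul_assoc, hcq]
  have hxy : x * y = q := by
    rw [hxdef, hydef, mul_assoc, ← mul_assoc (star b), hsbc, hpc, hbc]
  have hyx : y * x = q := by
    rw [hxdef, hydef, mul_assoc, ← mul_assoc c, hcb, hpsb, hscb]
  obtain ⟨hmul, h0, h1, hstar, hcont⟩ := cornerPow_properties hx hq hqx hxq hqy hyq hxy hyx
  have hqP (s : ℝ) : q * cornerPow q x s = cornerPow q x s := by
    simpa [h0] using hmul 0 s
  have hPq (s : ℝ) : cornerPow q x s * q = cornerPow q x s := by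
    simpa [h0] using hmul s 0
  have hneg : cornerPow q x (-1) = y := by
    have hx' := hmul (-1) 1
    rw [neg_add_cancel, h0, h1] at hx'
    rw [← hPq, ← congrArg (cornerPow q x (-1) * ·) hxy, ← mul_assoc, hx', hqy]
  have hvv : cornerPow q x (-(1 / 2)) * b * star (cornerPow q x (-(1 / 2)) * b) = q := by
    rw [star_mul, hstar, mul_assoc, ← mul_assoc b, ← hxdef]
    have hx' := hmul 1 (-(1 / 2))
    rw [h1] at hx'
    rw [hx', hmul]
    norm_num [h0]
  refine ⟨by rw [hqx, hxq], hx, by rw [hqy, hyq], hxy, hyx, ?_, ?_, hvv, ?_, ?_, rfl, ?_⟩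
  · rw [hvv, ← mul_assoc, hqP]
  · rw [star_mul, hstar, mul_assoc, ← mul_assoc (cornerPow q x _), hmul]
    norm_num only
    rw [hneg, hydef, mul_assoc, hcb, hscp, hsbc]
  · exact ((hcont.comp (by fun_prop : Continuous fun t : ℝ => -(t / 2))).mul
      continuous_const).continuousOn
  · rw [zero_div, neg_zero, h0, hqb]
  · intro t _
    refine ⟨?_, c * cornerPow q x (t / 2), ?_, ?_, ?_⟩
    · rw [IsMor, ← mul_assoc, hqP, mul_assoc, hbp]
    · rw [IsMor, ← mul_assoc, hpc, mul_assoc, hPq]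
    · rw [mul_assoc, ← mul_assoc (cornerPow q x _), hmul, add_neg_cancel, h0, hqb, hcb]
    · rw [mul_assoc, ← mul_assoc b, hbc, hqP, hmul, neg_add_cancel, h0]
end
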